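/- Let H' be the hybrid graph obtained from the closed blocked graph H by directing every edge with exactly one blocked end from its blocked end toward its unblocked end and making every other edge undirected. Then every flag A → B − C of H' is an induced subgraph of every chain graph F that is triplex equivalent to G. -/

import Mathlib

/-- There is an edge between `a` and `b`: a directed edge `a → b`, a directed edge
`b → a`, or an undirected edge `a − b`. -/
def Adj (dir und : V → V → Prop) (a b : V) : Prop :=
  dir a b ∨ dir b a ∨ und a b ∨ und b a

/-- A hybrid graph: undirected edges are symmetric, there are no self loops, and there
is at most one edge between any pair of distinct nodes. -/
def IsHybrid (dir und : V → V → Prop) : Prop :=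
  (∀ a b, und a b → und b a) ∧
  (∀ a b, dir a b → a ≠ b) ∧
  (∀ a b, und a b → a ≠ b) ∧
  (∀ a b, dir a b → ¬ dir b a) ∧
  (∀ a b, dir a b → ¬ und a b ∧ ¬ und b a)

/-- Every pair of consecutive elements of the list `l` is related by `R`. -/
def ChainRel (R : V → V → Prop) (l : List V) : Prop :=
  ∀ (i : ℕ) (a b : V), l[i]? = some a → l[i + 1]? = some b → R a b

/-- The list `l` is a route in the graph, i.e. consecutive nodes are adjacent
(and `l` is nonempty). -/
def IsRoute (dir und : V → V → Prop) (l : List V) : Prop :=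
  l ≠ [] ∧ ChainRel (Adj dir und) l

/-- The list `l` is a descending route: every step is `a → b` or `a − b`. -/
def IsDescRouteList (dir und : V → V → Prop) (l : List V) : Prop :=
  l ≠ [] ∧ ChainRel (fun a b => dir a b ∨ und a b) l

/-- There is a descending route from `a` to `b`. -/
def DescRoute (dir und : V → V → Prop) (a b : V) : Prop :=
  ∃ l : List V, l.head? = some a ∧ l.getLast? = some b ∧
    ChainRel (fun x y => dir x y ∨ und x y) l

/-- The list `l` is a semidirected cycle. -/
def SemidirectedCycle (dir und : V → V → Prop) (l : List V) : Prop :=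
  2 ≤ l.length ∧ l.head? = l.getLast? ∧
  ChainRel (fun a b => dir a b ∨ und a b) l ∧
  ∃ (i : ℕ) (a b : V), l[i]? = some a ∧ l[i + 1]? = some b ∧ dir a b

/-- A chain graph is a hybrid graph with no semidirected cycle. -/
def IsChainGraph (dir und : V → V → Prop) : Prop :=
  IsHybrid dir und ∧ ∀ l : List V, ¬ SemidirectedCycle dir und l

/-- The parents of the set of nodes `X`. -/
def pa (dir : V → V → Prop) (X : Set V) : Set V :=
  {v | v ∉ X ∧ ∃ w ∈ X, dir v w}

/-- The neighbors of the set of nodes `X`. -/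
def nbr (und : V → V → Prop) (X : Set V) : Set V :=
  {v | v ∉ X ∧ ∃ w ∈ X, und v w}

/-- The adjacents of the set of nodes `X`. -/
def adSet (dir und : V → V → Prop) (X : Set V) : Set V :=
  {v | v ∉ X ∧ ∃ w ∈ X, Adj dir und v w}

/-- The descendants of the set of nodes `X`. -/
def de (dir und : V → V → Prop) (X : Set V) : Set V :=
  {v | v ∉ X ∧ ∃ w ∈ X, DescRoute dir und w v}

/-- The connectivity component of the node `a`: all nodes reachable from `a` by a
route whose edges are all undirected. -/
def co (und : V → V → Prop) (a : V) : Set V :=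
  {b | Relation.ReflTransGen und a b}

/-- `b` is a head-no-tail node in the subroute `a, b, c`, i.e. the subroute is of
the form `a → b ← c`, `a → b − c` or `a − b ← c`. -/
def HeadNoTail (dir und : V → V → Prop) (a b c : V) : Prop :=
  (dir a b ∧ dir c b) ∨ (dir a b ∧ und b c) ∨ (und a b ∧ dir c b)

/-- The route `l` is `Z`-open: every head-no-tail (occurrence of a) node is in `Z`
and every other (occurrence of a) node is not in `Z`. -/
def ZOpen (dir und : V → V → Prop) (Z : Set V) (l : List V) : Prop :=
  ChainRel (Adj dir und) l ∧
  (∀ (i : ℕ) (a b c : V), l[i]? = some a → l[i + 1]? = some b → l[i + 2]? = some c →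
    (HeadNoTail dir und a b c ↔ b ∈ Z)) ∧
  (∀ a, l.head? = some a → a ∉ Z) ∧
  (∀ a, l.getLast? = some a → a ∉ Z)

/-- `X` is separated from `Y` given `Z`: there is no `Z`-open route between a node
of `X` and a node of `Y`. -/
def Separ (dir und : V → V → Prop) (X Y Z : Set V) : Prop :=
  ¬ ∃ (l : List V) (x y : V), x ∈ X ∧ y ∈ Y ∧ l.head? = some x ∧ l.getLast? = some y ∧
      ZOpen dir und Z l

/-- The graph has a triplex `({A,C},B)`: an induced subgraph of the form `A → B ← C`,
`A → B − C` or `A − B ← C`. -/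
def Triplex (dir und : V → V → Prop) (A B C : V) : Prop :=
  A ≠ C ∧ ¬ Adj dir und A C ∧
  ((dir A B ∧ dir C B) ∨ (dir A B ∧ und B C) ∨ (und A B ∧ dir C B))

/-- The graph has an immorality `A → B ← C`. -/
def Immorality (dir und : V → V → Prop) (A B C : V) : Prop :=
  A ≠ C ∧ ¬ Adj dir und A C ∧ dir A B ∧ dir C B

/-- The graph has a flag `A → B − C`. -/
def FlagIn (dir und : V → V → Prop) (A B C : V) : Prop :=
  A ≠ C ∧ ¬ Adj dir und A C ∧ dir A B ∧ und B C

/-- The least set of blocks over the skeleton of the graph closed under the rules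
R1-R4. `Blocked dir und S a b` means that the `a`-end of the edge `a - b` is blocked.
`S A B` is the fixed separator found for the nonadjacent pair `{A, B}`. -/
inductive Blocked (dir und : V → V → Prop) (S : V → V → Set V) : V → V → Prop where
  /-- R1 blocks the `A`-end of the edge `A - B`. -/
  | R1a (A B C : V) : Adj dir und A B → Adj dir und B C → A ≠ C → ¬ Adj dir und A C →
      B ∉ S A C → Blocked dir und S A B
  /-- R1 blocks the `C`-end of the edge `B - C`. -/
  | R1b (A B C : V) : Adj dir und A B → Adj dir und B C → A ≠ C → ¬ Adj dir und A C →
      B ∉ S A C → Blocked dir und S C B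
  | R2 (A B C : V) : Blocked dir und S A B → Adj dir und B C → A ≠ C → ¬ Adj dir und A C →
      B ∈ S A C → Blocked dir und S B C
  | R3 (A B : V) (l : List V) : l.head? = some A → l.getLast? = some B → 2 ≤ l.length →
      (∀ (i : ℕ) (a b : V), l[i]? = some a → l[i + 1]? = some b → Adj dir und a b) →
      (∀ (i : ℕ) (a b : V), l[i]? = some a → l[i + 1]? = some b → Blocked dir und S a b) →
      Adj dir und A B → Blocked dir und S A B
  | R4 (A B C D : V) : Adj dir und A B → Adj dir und A C → Adj dir und A D →
      Adj dir und C B → Adj dir und D B → Blocked dir und S C B → Blocked dir und S D B →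
      C ≠ D → ¬ Adj dir und C D → A ∈ S C D → B ∉ S C D → Blocked dir und S A B

/-- The directed edges of the hybrid graph `H'` obtained from the closed blocked graph:
an edge whose `a`-end is blocked and whose `b`-end is unblocked is directed as `a → b`. -/
def blkDir (dir und : V → V → Prop) (S : V → V → Set V) (a b : V) : Prop :=
  Adj dir und a b ∧ Blocked dir und S a b ∧ ¬ Blocked dir und S b a

/-- The undirected edges of the hybrid graph `H'` obtained from the closed blocked graph:
an edge with both ends blocked or both ends unblocked is undirected. -/
def blkUnd (dir und : V → V → Prop) (S : V → V → Set V) (a b : V) : Prop :=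
  Adj dir und a b ∧ (Blocked dir und S a b ↔ Blocked dir und S b a)

theorem Adj.symm {V : Type*} {dir und : V → V → Prop} {a b : V} (h : Adj dir und a b) :
    Adj dir und b a := by
  unfold Adj at *; tauto

/-- For nonadjacent `A` and `C` with common adjacent `B`, a separator of `A` and `C` avoids `B`
exactly when `B` carries a triplex. -/
theorem triplex_iff_notMem_of_separ {V : Type*} {dir und : V → V → Prop} {A B C : V} {Z : Set V}
    (hAC : A ≠ C) (hnAC : ¬ Adj dir und A C) (hAB : Adj dir und A B) (hBC : Adj dir und B C)
    (hZ : Z ⊆ ({A, C} : Set V)ᶜ) (hsep : Separ dir und {A} {C} Z) :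
    Triplex dir und A B C ↔ B ∉ Z := by
  have hA : A ∉ Z := fun h => hZ h (by simp)
  have hC : C ∉ Z := fun h => hZ h (by simp)
  have key : ¬ (HeadNoTail dir und A B C ↔ B ∈ Z) := by
    intro hiff
    refine hsep ⟨[A, B, C], A, C, rfl, rfl, rfl, rfl, ?_, ?_, ?_, ?_⟩
    · intro i a b ha hb
      match i with
      | 0 => simp at ha hb; subst ha hb; exact hAB
      | 1 => simp at ha hb; subst ha hb; exact hBC
      | i + 2 => simp at hb
    · intro i a b c ha hb hc
      match i with
      | 0 => simp at ha hb hc; subst ha hb hc; exact hiff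
      | i + 1 => simp at hc
    · intro a ha; simp at ha; subst ha; exact hA
    · intro a ha; simp at ha; subst ha; exact hC
  unfold Triplex
  unfold HeadNoTail at key
  tauto

/-- A directed edge cannot close a descending route into a cycle. -/
theorem IsChainGraph.not_dir_of_descending {V : Type*} {dir und : V → V → Prop}
    (hF : IsChainGraph dir und) {A B : V} {l : List V} (hA : l.head? = some A)
    (hB : l.getLast? = some B) (hl : ChainRel (fun a b => dir a b ∨ und a b) l) :
    ¬ dir B A := by
  intro hBA
  have hne : l ≠ [] := by rintro rfl; simp at hA
  have hpos : 0 < l.length := List.length_pos_iff.2 hne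
  have hlast : l[l.length - 1]? = some B := by rw [← hB, List.getLast?_eq_getElem?]
  refine hF.2 (l ++ [A]) ⟨by simp; omega, by simp [hA], ?_,
    l.length - 1, B, A, ?_, ?_, hBA⟩
  · intro i a b ha hb
    rcases lt_trichotomy (i + 1) l.length with h | h | h
    · rw [List.getElem?_append_left (by omega)] at ha hb
      exact hl i a b ha hb
    · rw [List.getElem?_append_left (by omega)] at ha
      rw [List.getElem?_append_right (by omega)] at hb
      obtain rfl : i = l.length - 1 := by omega
      rw [hlast] at ha
      simp [h] at ha hb
      subst ha hb
      exact Or.inl hBA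
    · rw [List.getElem?_eq_none (by simp; omega)] at hb
      simp at hb
  · rw [List.getElem?_append_left (by omega), hlast]
  · rw [List.getElem?_append_right (by omega)]
    simp [Nat.sub_add_cancel hpos]

/-- In a chain graph, `a → b → c` or `a − b → c` with `a` and `c` adjacent forces `a → c`. -/
theorem IsChainGraph.dir_of_triangle {V : Type*} {dir und : V → V → Prop}
    (hF : IsChainGraph dir und) {a b c : V} (hab : dir a b ∨ und a b) (hbc : dir b c)
    (hac : Adj dir und a c) : dir a c := by
  by_contra h
  have hca : dir c a ∨ und c a := by
    have := hF.1.1 a c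
    unfold Adj at hac; tauto
  refine hF.not_dir_of_descending (A := c) (B := b) (l := [c, a, b]) rfl rfl ?_ hbc
  intro i x y hx hy
  match i with
  | 0 => simp at hx hy; subst hx hy; exact hca
  | 1 => simp at hx hy; subst hx hy; exact hab
  | i + 2 => simp at hy

/-- A blocked end carries no arrowhead in a chain graph whose triplexes are exactly those
read off from the separators. -/
theorem Blocked.not_dir {V : Type*} {dir und dirF undF : V → V → Prop} {S : V → V → Set V}
    (hF : IsChainGraph dirF undF)
    (hadj : ∀ a b : V, Adj dirF undF a b ↔ Adj dir und a b)
    (htri : ∀ A B C : V, Adj dir und A B → Adj dir und B C → A ≠ C → ¬ Adj dir und A C →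
      (Triplex dirF undF A B C ↔ B ∉ S A C))
    {A B : V} (h : Blocked dir und S A B) : ¬ dirF B A := by
  obtain ⟨hsymm, -, -, hdd, hdu⟩ := hF.1
  induction h with
  | R1a A B C hAB hBC hAC hnAC hB =>
    obtain ⟨-, -, ht⟩ := (htri A B C hAB hBC hAC hnAC).2 hB
    intro hBA
    have := hdd B A hBA
    have := hdu B A hBA
    tauto
  | R1b A B C hAB hBC hAC hnAC hB =>
    obtain ⟨-, -, ht⟩ := (htri A B C hAB hBC hAC hnAC).2 hB
    intro hBC'
    have := hdd B C hBC'
    have := hdu B C hBC'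
    tauto
  | R2 A B C hblk hBC hAC hnAC hB ih =>
    intro hCB
    have hAB : Adj dir und A B := by
      cases hblk with
      | R1a _ _ _ h => exact h
      | R1b _ _ _ _ h => exact h.symm
      | R2 _ _ _ _ h => exact h
      | R3 _ _ _ _ _ _ _ _ h => exact h
      | R4 _ _ _ _ h => exact h
    refine (htri A B C hAB hBC hAC hnAC).1 ⟨hAC, (hadj A C).not.2 hnAC, ?_⟩ hB
    have hABF := (hadj A B).2 hAB
    have := hsymm B A
    unfold Adj at hABF; tauto
  | R3 A B l hA hB hlen hadjl hblk hAB ih =>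
    refine hF.not_dir_of_descending hA hB ?_
    intro i a b ha hb
    have h₁ := ih i a b ha hb
    have h₂ := (hadj a b).2 (hadjl i a b ha hb)
    have := hsymm b a
    unfold Adj at h₂; tauto
  | R4 A B C D hAB hAC hAD hCB hDB hC hD hCD hnCD hA hB ihC ihD =>
    intro hBA
    have desc : ∀ {X}, Adj dir und X B → ¬ dirF B X → dirF X B ∨ undF X B := by
      intro X hXB hn
      have h₂ := (hadj X B).2 hXB
      have := hsymm B X
      unfold Adj at h₂; tauto
    exact (htri C A D hAC.symm hAD hCD hnCD).1 ⟨hCD, (hadj C D).not.2 hnCD, Or.inl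
      ⟨hF.dir_of_triangle (desc hCB ihC) hBA ((hadj C A).2 hAC.symm),
       hF.dir_of_triangle (desc hDB ihD) hBA ((hadj D A).2 hAD.symm)⟩⟩ hA

theorem stmt_17 {V : Type} [Fintype V] (dir und : V → V → Prop)
    (hG : IsChainGraph dir und) (S : V → V → Set V)
    (hSsymm : ∀ A B : V, S A B = S B A)
    (hSsep : ∀ A B : V, A ≠ B → ¬ Adj dir und A B →
      S A B ⊆ ({A, B} : Set V)ᶜ ∧ Separ dir und {A} {B} (S A B)) :
    ∀ A B C : V, FlagIn (blkDir dir und S) (blkUnd dir und S) A B C →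
    ∀ dirF undF : V → V → Prop, IsChainGraph dirF undF →
      (∀ a b : V, Adj dirF undF a b ↔ Adj dir und a b) →
      (∀ X Y Z : V, Triplex dirF undF X Y Z ↔ Triplex dir und X Y Z) →
      dirF A B ∧ undF B C ∧ ¬ Adj dirF undF A C := by
  intro A B C hflag dirF undF hF hadj htriF
  obtain ⟨hAC, hn, ⟨hAB, hbAB, hnBA⟩, hBC, hiff⟩ := hflag
  have hnAC : ¬ Adj dir und A C := by
    intro h
    have := h.symm
    unfold Adj blkDir blkUnd at hn
    tauto
  have htri : ∀ X Y Z : V, Adj dir und X Y → Adj dir und Y Z → X ≠ Z → ¬ Adj dir und X Z →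
      (Triplex dirF undF X Y Z ↔ Y ∉ S X Z) := by
    intro X Y Z hXY hYZ hXZ hnXZ
    obtain ⟨hS, hsep⟩ := hSsep X Z hXZ hnXZ
    exact (htriF X Y Z).trans (triplex_iff_notMem_of_separ hXZ hnXZ hXY hYZ hS hsep)
  have hB : B ∉ S A C := by
    intro hB
    have hCB := hiff.1 (Blocked.R2 A B C hbAB hBC hAC hnAC hB)
    exact hnBA (Blocked.R2 C B A hCB hAB.symm hAC.symm (fun h => hnAC h.symm) (hSsymm A C ▸ hB))
  have hbCB : Blocked dir und S C B := Blocked.R1b A B C hAB hBC hAC hnAC hB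
  have hBC' := (hiff.2 hbCB).not_dir hF hadj htri
  have hCB' := hbCB.not_dir hF hadj htri
  obtain ⟨-, hnF, ht⟩ := (htri A B C hAB hBC hAC hnAC).2 hB
  have hundBC : undF B C := by
    rcases (hadj B C).2 hBC with h | h | h | h
    exacts [absurd h hCB', absurd h hBC', h, hF.1.1 C B h]
  refine ⟨?_, hundBC, hnF⟩
  rcases ht with h | h | h
  exacts [h.1, h.1, absurd h.2 hBC']
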